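/- Let K be an infinite compact subset of ℝ^d. If [a,b] is any interval such that the set of measures μ ∈ P(K) with D̄_μ(1) ∈ [a,b] is residual in P(K), then a ≤ dim̄_{B,conv}(K) and b ≥ dim̄_{B,conv,max}(K). -/

import Mathlib

open MeasureTheory Filter Metric Set Topology

noncomputable section

/-- `ℝ^d` with the Euclidean metric. -/
abbrev Euc (d : ℕ) : Type := EuclideanSpace ℝ (Fin d)

/-- The largest number of pairwise disjoint balls of radius `r` with centers in `E`. -/
noncomputable def packingNumber {X : Type*} [MetricSpace X] (E : Set X) (r : ℝ) : ℕ :=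
  sSup {n : ℕ | ∃ c : Fin n → X, (∀ i, c i ∈ E) ∧
    Pairwise fun i j => Disjoint (ball (c i) r) (ball (c j) r)}

/-- The smallest number of balls of radius `r` needed to cover `E`. -/
noncomputable def coveringNumber {X : Type*} [MetricSpace X] (E : Set X) (r : ℝ) : ℕ :=
  sInf {n : ℕ | ∃ c : Fin n → X, E ⊆ ⋃ i, ball (c i) r}

/-- Upper box (Minkowski) dimension. -/
noncomputable def upperBoxDim {X : Type*} [MetricSpace X] (E : Set X) : EReal :=
  limsup (fun r : ℝ => ((Real.log (coveringNumber E r : ℝ) / (-Real.log r) : ℝ) : EReal))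
    (𝓝[>] (0:ℝ))

/-- Lower box (Minkowski) dimension. -/
noncomputable def lowerBoxDim {X : Type*} [MetricSpace X] (E : Set X) : EReal :=
  liminf (fun r : ℝ => ((Real.log (coveringNumber E r : ℝ) / (-Real.log r) : ℝ) : EReal))
    (𝓝[>] (0:ℝ))

/-- Packing dimension, defined as the modified upper box dimension. -/
noncomputable def packingDim {X : Type*} [MetricSpace X] (E : Set X) : EReal :=
  ⨅ (F : ℕ → Set X) (_ : E ⊆ ⋃ n, F n), ⨆ n, upperBoxDim (F n)

/-- The local uniform upper box dimension. -/
noncomputable def locUnifUpperBoxDim {X : Type*} [MetricSpace X] (K : Set X) : EReal :=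
  ⨅ (N : ℕ) (_ : 1 ≤ N) (x : Fin N → X) (_ : ∀ i, x i ∈ K) (r₀ : ℝ) (_ : 0 < r₀),
    limsup (fun r : ℝ =>
      ((⨅ i : Fin N, Real.log (packingNumber (K ∩ ball (x i) r₀) r : ℝ) / (-Real.log r) : ℝ)
        : EReal)) (𝓝[>] (0:ℝ))

/-- The convex upper box dimension. -/
noncomputable def convUpperBoxDim {X : Type*} [MetricSpace X] (K : Set X) : EReal :=
  ⨅ (N : ℕ) (_ : 1 ≤ N) (x : Fin N → X) (_ : ∀ i, x i ∈ K) (ρ : ℝ) (_ : 0 < ρ)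
    (p : Fin N → ℝ) (_ : ∀ i, 0 < p i) (_ : ∑ i, p i = 1),
    limsup (fun r : ℝ =>
      (((∑ i, p i * Real.log (packingNumber (K ∩ ball (x i) ρ) r : ℝ)) / (-Real.log r) : ℝ)
        : EReal)) (𝓝[>] (0:ℝ))

/-- The maximal convex upper box dimension. -/
noncomputable def convUpperBoxDimMax {X : Type*} [MetricSpace X] (K : Set X) : EReal :=
  ⨆ (y : X) (_ : y ∈ K) (ρ : ℝ) (_ : 0 < ρ), convUpperBoxDim (K ∩ ball y ρ)

/-- `I_μ(r,q)`, with the logarithmic convention at `q = 1`. -/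
noncomputable def Iq {X : Type*} [MetricSpace X] [MeasurableSpace X]
    (μ : Measure X) (r q : ℝ) : ℝ :=
  if q = 1 then ∫ x, Real.log ((μ (ball x r)).toReal) ∂μ
  else ∫ x, ((μ (ball x r)).toReal) ^ (q - 1) ∂μ

/-- The quantity whose `liminf`/`limsup` as `r → 0⁺` gives the lower/upper `L^q`-dimensions. -/
noncomputable def Dq {X : Type*} [MetricSpace X] [MeasurableSpace X]
    (μ : Measure X) (r q : ℝ) : ℝ :=
  if q = 1 then Iq μ r 1 / Real.log r
  else (1 / (q - 1)) * (Real.log (Iq μ r q) / Real.log r)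

/-- The upper `L^q`-dimension of a measure. -/
noncomputable def upperDim {X : Type*} [MetricSpace X] [MeasurableSpace X]
    (μ : Measure X) (q : ℝ) : EReal :=
  limsup (fun r : ℝ => ((Dq μ r q : ℝ) : EReal)) (𝓝[>] (0:ℝ))

/-- The lower `L^q`-dimension of a measure. -/
noncomputable def lowerDim {X : Type*} [MetricSpace X] [MeasurableSpace X]
    (μ : Measure X) (q : ℝ) : EReal :=
  liminf (fun r : ℝ => ((Dq μ r q : ℝ) : EReal)) (𝓝[>] (0:ℝ))

/-- The (topological) support of a measure. -/
noncomputable def msupport {X : Type*} [MetricSpace X] [MeasurableSpace X]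
    (μ : Measure X) : Set X :=
  {x | ∀ r > (0:ℝ), 0 < μ (ball x r)}

/-- The upper `L^∞`-dimension of a measure. -/
noncomputable def upperDimInfty {X : Type*} [MetricSpace X] [MeasurableSpace X]
    (μ : Measure X) : EReal :=
  limsup (fun r : ℝ =>
    ((Real.log (⨆ x ∈ msupport μ, (μ (ball x r)).toReal) / Real.log r : ℝ) : EReal))
    (𝓝[>] (0:ℝ))

/-- The lower `L^∞`-dimension of a measure. -/
noncomputable def lowerDimInfty {X : Type*} [MetricSpace X] [MeasurableSpace X]
    (μ : Measure X) : EReal :=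
  liminf (fun r : ℝ =>
    ((Real.log (⨆ x ∈ msupport μ, (μ (ball x r)).toReal) / Real.log r : ℝ) : EReal))
    (𝓝[>] (0:ℝ))

/-- The upper `L^{-∞}`-dimension of a measure. -/
noncomputable def upperDimNegInfty {X : Type*} [MetricSpace X] [MeasurableSpace X]
    (μ : Measure X) : EReal :=
  limsup (fun r : ℝ =>
    ((Real.log (⨅ x ∈ msupport μ, (μ (ball x r)).toReal) / Real.log r : ℝ) : EReal))
    (𝓝[>] (0:ℝ))

/-- The lower `L^{-∞}`-dimension of a measure. -/
noncomputable def lowerDimNegInfty {X : Type*} [MetricSpace X] [MeasurableSpace X]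
    (μ : Measure X) : EReal :=
  liminf (fun r : ℝ =>
    ((Real.log (⨅ x ∈ msupport μ, (μ (ball x r)).toReal) / Real.log r : ℝ) : EReal))
    (𝓝[>] (0:ℝ))

/-- The half-closed dyadic cube of side `2^{-n}` indexed by `k`. -/
noncomputable def dyadicCube (d n : ℕ) (k : Fin d → ℤ) : Set (Euc d) :=
  {x | ∀ j, (k j : ℝ) / 2 ^ n ≤ x j ∧ x j < ((k j : ℝ) + 1) / 2 ^ n}

/-- `K_n`: the union of the half-closed dyadic cubes of side `2^{-n}` meeting `K`. -/
noncomputable def dyadicHull (d : ℕ) (K : Set (Euc d)) (n : ℕ) : Set (Euc d) :=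
  ⋃ (k : Fin d → ℤ) (_ : (dyadicCube d n k ∩ K).Nonempty), dyadicCube d n k

/-- The number of connected components of a set. -/
noncomputable def numComponents {X : Type*} [TopologicalSpace X] (S : Set X) : ℕ :=
  Nat.card {C : Set X // ∃ x ∈ S, C = connectedComponentIn S x}

/-- The box separation index `bsi(K)`. -/
noncomputable def bsi (d : ℕ) (K : Set (Euc d)) : ℝ :=
  liminf (fun n : ℕ =>
    Real.log (numComponents (dyadicHull d K n) : ℝ) / (n * Real.log 2)) atTop

/-- The Fortet–Mourier distance between two measures. -/
noncomputable def FMdist {X : Type*} [MetricSpace X] [MeasurableSpace X]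
    (μ ν : Measure X) : ℝ :=
  ⨆ f : {f : X → ℝ // LipschitzWith 1 f ∧ ∀ x, |f x| ≤ 1},
    |∫ x, f.1 x ∂μ - ∫ x, f.1 x ∂ν|



section Packing

/-- Packings of a bounded subset of `ℝ^d` obey the volume bound. -/
lemma packing_card_le {d : ℕ} {E : Set (Euc d)} {M r : ℝ} (hM : 0 ≤ M) (hr : 0 < r)
    (hE : E ⊆ ball 0 M) {n : ℕ} {c : Fin n → Euc d} (hc : ∀ i, c i ∈ E)
    (hdisj : Pairwise fun i j => Disjoint (ball (c i) r) (ball (c j) r)) :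
    (n : ℝ) ≤ ((M + r) / r) ^ d := by
  have hsub : (⋃ i, ball (c i) r) ⊆ ball (0 : Euc d) (M + r) := by
    refine iUnion_subset fun i => ball_subset_ball' ?_
    have := hE (hc i)
    rw [mem_ball] at this
    linarith
  have hvol := measure_mono (μ := volume) hsub
  rw [measure_iUnion hdisj fun i => measurableSet_ball, tsum_fintype] at hvol
  have h0 : volume (ball (0 : Euc d) 1) ≠ 0 := (measure_ball_pos _ _ one_pos).ne'
  have h1 : volume (ball (0 : Euc d) 1) ≠ ⊤ := measure_ball_lt_top.ne
  simp only [Measure.addHaar_ball_of_pos _ _ hr,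
    Measure.addHaar_ball_of_pos _ _ (by linarith : 0 < M + r), Finset.sum_const,
    Finset.card_univ, Fintype.card_fin, finrank_euclideanSpace, nsmul_eq_mul] at hvol
  rw [← mul_assoc, ENNReal.mul_le_mul_iff_left h0 h1, ← ENNReal.ofReal_natCast,
    ← ENNReal.ofReal_mul (by positivity), ENNReal.ofReal_le_ofReal_iff (by positivity)] at hvol
  rw [div_pow, le_div_iff₀ (by positivity)]
  exact hvol

lemma bddAbove_packing {d : ℕ} {E : Set (Euc d)} (hE : Bornology.IsBounded E) {r : ℝ}
    (hr : 0 < r) :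
    BddAbove {n : ℕ | ∃ c : Fin n → Euc d, (∀ i, c i ∈ E) ∧
      Pairwise fun i j => Disjoint (ball (c i) r) (ball (c j) r)} := by
  obtain ⟨M, hM0, hM⟩ := hE.subset_ball_lt 0 0
  refine ⟨⌊((M + r) / r) ^ d⌋₊, ?_⟩
  rintro n ⟨c, hc, hd⟩
  exact Nat.le_floor (packing_card_le hM0.le hr hM hc hd)

lemma exists_packing {d : ℕ} {E : Set (Euc d)} (hE : Bornology.IsBounded E) {r : ℝ}
    (hr : 0 < r) :
    ∃ c : Fin (_root_.packingNumber E r) → Euc d, (∀ i, c i ∈ E) ∧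
      Pairwise fun i j => Disjoint (ball (c i) r) (ball (c j) r) :=
  Nat.sSup_mem (s := {n : ℕ | ∃ c : Fin n → Euc d, (∀ i, c i ∈ E) ∧
      Pairwise fun i j => Disjoint (ball (c i) r) (ball (c j) r)})
    ⟨0, fun i => i.elim0, fun i => i.elim0, fun i => i.elim0⟩ (bddAbove_packing hE hr)

/-- A maximal packing by balls of radius `r` is a covering by balls of radius `2r`. -/
lemma exists_packing_cover {d : ℕ} {E : Set (Euc d)} (hE : Bornology.IsBounded E) {r : ℝ}
    (hr : 0 < r) :
    ∃ c : Fin (_root_.packingNumber E r) → Euc d, (∀ i, c i ∈ E) ∧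
      ∀ x ∈ E, ∃ i, dist x (c i) < 2 * r := by
  obtain ⟨c, hc, hd⟩ := exists_packing hE hr
  refine ⟨c, hc, fun x hx => ?_⟩
  by_contra! hfar
  have hdx : ∀ i, Disjoint (ball x r) (ball (c i) r) := fun i =>
    ball_disjoint_ball (by linarith [hfar i])
  have hmem : _root_.packingNumber E r + 1 ∈ {n : ℕ | ∃ c : Fin n → Euc d, (∀ i, c i ∈ E) ∧
      Pairwise fun i j => Disjoint (ball (c i) r) (ball (c j) r)} := by
    refine ⟨Fin.cons x c, fun i => ?_, fun i j hij => ?_⟩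
    · refine Fin.cases ?_ (fun i => ?_) i
      · simpa using hx
      · simpa using hc i
    · induction i using Fin.cases with
      | zero =>
        induction j using Fin.cases with
        | zero => exact absurd rfl hij
        | succ j => simpa using hdx j
      | succ i =>
        induction j using Fin.cases with
        | zero => simpa using (hdx i).symm
        | succ j =>
          simpa using hd (fun h => hij (by rw [h]))
  exact Nat.not_succ_le_self _ (le_csSup (bddAbove_packing hE hr) hmem)

lemma packingNumber_mono {d : ℕ} {E F : Set (Euc d)} (hF : Bornology.IsBounded F) (h : E ⊆ F)
    {r : ℝ} (hr : 0 < r) : _root_.packingNumber E r ≤ _root_.packingNumber F r := by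
  obtain ⟨c, hc, hd⟩ := exists_packing (hF.subset h) hr
  exact le_csSup (bddAbove_packing hF hr) ⟨c, fun i => h (hc i), hd⟩

lemma packingNumber_pos {d : ℕ} {E : Set (Euc d)} (hE : Bornology.IsBounded E)
    (hne : E.Nonempty) {r : ℝ} (hr : 0 < r) : 0 < _root_.packingNumber E r := by
  obtain ⟨c, -, h⟩ := exists_packing_cover hE hr
  obtain ⟨x, hx⟩ := hne
  obtain ⟨i, -⟩ := h x hx
  exact i.pos

lemma tendsto_neg_log_nhdsGT_zero : Tendsto (fun r : ℝ => -Real.log r) (𝓝[>] 0) atTop :=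
  tendsto_neg_atBot_atTop.comp Real.tendsto_log_nhdsGT_zero

lemma eventually_log_packingNumber_le {d : ℕ} {E : Set (Euc d)} (hE : Bornology.IsBounded E)
    (hne : E.Nonempty) :
    ∀ᶠ r in 𝓝[>] (0 : ℝ), Real.log (_root_.packingNumber E r) ≤ (d + 1) * -Real.log r := by
  obtain ⟨M, hM0, hM⟩ := hE.subset_ball_lt 0 0
  filter_upwards [tendsto_neg_log_nhdsGT_zero.eventually_ge_atTop (d * Real.log (M + 1)),
    Ioo_mem_nhdsGT (zero_lt_one (α := ℝ))] with r hr hr01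
  obtain ⟨hr0, hr1⟩ := hr01
  obtain ⟨c, hc, hd⟩ := exists_packing hE hr0
  have h1 := packing_card_le hM0.le hr0 hM hc hd
  have h2 : ((M + r) / r) ^ d ≤ ((M + 1) / r) ^ d := by gcongr
  have h3 : Real.log (_root_.packingNumber E r) ≤ Real.log (((M + 1) / r) ^ d) :=
    Real.log_le_log (by exact_mod_cast packingNumber_pos hE hne hr0) (h1.trans h2)
  rw [Real.log_pow, Real.log_div (by positivity) hr0.ne'] at h3
  linarith

/-- Centers of disjoint balls of radius `r` in a Euclidean space are `2r`-separated. -/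
lemma two_mul_le_dist_of_disjoint_ball {d : ℕ} {x y : Euc d} {r : ℝ}
    (h : Disjoint (ball x r) (ball y r)) : 2 * r ≤ dist x y := by
  by_contra! hlt
  have h1 : midpoint ℝ x y ∈ ball x r := by
    rw [mem_ball, dist_midpoint_left]
    norm_num
    linarith
  have h2 : midpoint ℝ x y ∈ ball y r := by
    rw [mem_ball, dist_midpoint_right]
    norm_num
    linarith
  exact Set.disjoint_left.1 h h1 h2

end Packing

section Information

variable {X : Type*} [MetricSpace X] [MeasurableSpace X]

lemma measurable_measure_ball [BorelSpace X] [SecondCountableTopology X]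
    (ν : Measure X) [SFinite ν] (r : ℝ) :
    Measurable fun x => ν (ball x r) := by
  have h : MeasurableSet {p : X × X | dist p.2 p.1 < r} :=
    measurableSet_lt (measurable_snd.dist measurable_fst) measurable_const
  exact measurable_measure_prodMk_left h

lemma measurable_neg_log_measure_ball [BorelSpace X] [SecondCountableTopology X]
    (ν : Measure X) [SFinite ν] (r : ℝ) :
    Measurable fun x => -Real.log (ν (ball x r)).toReal :=
  (Real.measurable_log.comp (measurable_measure_ball ν r).ennreal_toReal).neg

lemma neg_log_measure_ball_nonneg (ν : Measure X) [IsProbabilityMeasure ν] (r : ℝ) (x : X) :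
    0 ≤ -Real.log (ν (ball x r)).toReal :=
  neg_nonneg.2 (Real.log_nonpos ENNReal.toReal_nonneg measureReal_le_one)

lemma neg_log_le_log_add {n v : ℝ} (hn : 1 ≤ n) (hv : 0 ≤ v) :
    -Real.log v ≤ Real.log n + 1 / (n * v) := by
  rcases hv.eq_or_lt with rfl | hv
  · simpa using Real.log_nonneg hn
  · have h := Real.log_le_sub_one_of_pos (x := 1 / (n * v)) (by positivity)
    rw [one_div, Real.log_inv, Real.log_mul (by positivity) hv.ne'] at h
    rw [one_div]
    linarith

/-- The information of a set covered by `n` balls of radius `s`, at scale `2s`. -/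
lemma setLIntegral_neg_log_measure_ball_le [BorelSpace X] (ν : Measure X)
    [IsProbabilityMeasure ν] {E : Set X} {s : ℝ} {n : ℕ} (hn : 1 ≤ n)
    (c : Fin n → X) (hE : ∀ x ∈ E, ∃ i, dist x (c i) < s) :
    ∫⁻ x in E, ENNReal.ofReal (-Real.log (ν (ball x (2 * s))).toReal) ∂ν ≤
      ENNReal.ofReal (ν.real E * Real.log n + 1) := by
  have hn' : (1 : ℝ) ≤ n := by exact_mod_cast hn
  have hball : ∀ i, ∫⁻ x in ball (c i) s,
      ENNReal.ofReal (1 / (n * (ν (ball x (2 * s))).toReal)) ∂ν ≤ ENNReal.ofReal (1 / n) := by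
    intro i
    rcases eq_or_ne (ν (ball (c i) s)) 0 with h0 | h0
    · rw [Measure.restrict_eq_zero.2 h0]
      simp
    have hpos : 0 < (ν (ball (c i) s)).toReal := ENNReal.toReal_pos h0 (measure_ne_top _ _)
    calc _ ≤ ∫⁻ x in ball (c i) s, ENNReal.ofReal (1 / (n * (ν (ball (c i) s)).toReal)) ∂ν := by
          refine setLIntegral_mono' measurableSet_ball fun x hx => ENNReal.ofReal_le_ofReal ?_
          have hsub : ball (c i) s ⊆ ball x (2 * s) := by
            refine ball_subset_ball' ?_
            rw [mem_ball, dist_comm] at hx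
            linarith
          have := ENNReal.toReal_mono (measure_ne_top ν _) (measure_mono (μ := ν) hsub)
          gcongr
      _ = ENNReal.ofReal (1 / n) := by
          rw [setLIntegral_const]
          nth_rewrite 2 [← ENNReal.ofReal_toReal (measure_ne_top ν (ball (c i) s))]
          rw [← ENNReal.ofReal_mul (by positivity)]
          congr 1
          field_simp
  calc _ ≤ ∫⁻ x in E, (ENNReal.ofReal (Real.log n) +
        ENNReal.ofReal (1 / (n * (ν (ball x (2 * s))).toReal))) ∂ν := by
        refine lintegral_mono fun x => ?_
        rw [← ENNReal.ofReal_add (Real.log_nonneg hn') (by positivity)]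
        exact ENNReal.ofReal_le_ofReal (neg_log_le_log_add hn' ENNReal.toReal_nonneg)
    _ = ENNReal.ofReal (Real.log n) * ν E +
        ∫⁻ x in E, ENNReal.ofReal (1 / (n * (ν (ball x (2 * s))).toReal)) ∂ν := by
        rw [lintegral_add_left measurable_const, setLIntegral_const]
    _ ≤ ENNReal.ofReal (Real.log n) * ν E + ∑ i : Fin n, ENNReal.ofReal (1 / n) := by
        gcongr
        refine (lintegral_mono_set (t := ⋃ i, ball (c i) s) fun x hx => ?_).trans
          ((lintegral_iUnion_le _ _).trans ?_)
        · obtain ⟨i, hi⟩ := hE x hx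
          exact mem_iUnion.2 ⟨i, hi⟩
        · rw [tsum_fintype]
          exact Finset.sum_le_sum fun i _ => hball i
    _ = ENNReal.ofReal (ν.real E * Real.log n + 1) := by
        rw [Finset.sum_const, Finset.card_univ, Fintype.card_fin, nsmul_eq_mul,
          ← ENNReal.ofReal_natCast, ← ENNReal.ofReal_mul (by positivity),
          mul_one_div_cancel (by positivity), ENNReal.ofReal_add
            (mul_nonneg measureReal_nonneg (Real.log_nonneg hn')) zero_le_one,
          ENNReal.ofReal_mul measureReal_nonneg, mul_comm, Measure.real,
          ENNReal.ofReal_toReal (measure_ne_top _ _)]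

lemma integrable_neg_log_measure_ball [BorelSpace X] [SecondCountableTopology X]
    [CompactSpace X] (ν : Measure X) [IsProbabilityMeasure ν] {r : ℝ} (hr : 0 < r) :
    Integrable (fun x => -Real.log (ν (ball x r)).toReal) ν := by
  have : Nonempty X := nonempty_of_isProbabilityMeasure ν
  obtain ⟨t, -, ht, hcov⟩ := (isCompact_univ (X := X)).finite_cover_balls (half_pos hr)
  lift t to Finset X using ht
  have hcard : 1 ≤ t.card := by
    obtain ⟨x⟩ := this
    obtain ⟨y, hy, -⟩ := mem_iUnion₂.1 (hcov (mem_univ x))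
    exact Finset.card_pos.2 ⟨y, hy⟩
  have h := setLIntegral_neg_log_measure_ball_le ν (E := univ) (s := r / 2) hcard
    (fun i => (t.equivFin.symm i : X)) fun x hx => by
      obtain ⟨y, hy, hxy⟩ := mem_iUnion₂.1 (hcov hx)
      exact ⟨t.equivFin ⟨y, hy⟩, by simpa using hxy⟩
  rw [Measure.restrict_univ, mul_div_cancel₀ _ (two_ne_zero (α := ℝ))] at h
  refine ⟨(measurable_neg_log_measure_ball ν r).aestronglyMeasurable, ?_⟩
  rw [hasFiniteIntegral_iff_ofReal (ae_of_all _ (neg_log_measure_ball_nonneg ν r))]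
  exact h.trans_lt ENNReal.ofReal_lt_top

/-- The information at scale `2s` is controlled by coverings at scale `s` of the members of any
finite covering of the space. -/
lemma integral_neg_log_measure_ball_le [BorelSpace X] [SecondCountableTopology X]
    (ν : Measure X) [IsProbabilityMeasure ν] {κ : Type*}
    [Fintype κ] {E : κ → Set X} (hEuniv : ⋃ k, E k = univ) {s : ℝ} (n : κ → ℕ)
    (hn : ∀ k, 1 ≤ n k) (c : ∀ k, Fin (n k) → X)
    (hE : ∀ k, ∀ x ∈ E k, ∃ i, dist x (c k i) < s) :
    ∫ x, -Real.log (ν (ball x (2 * s))).toReal ∂ν ≤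
      ∑ k, (ν.real (E k) * Real.log (n k) + 1) := by
  have hterm : ∀ k, 0 ≤ ν.real (E k) * Real.log (n k) + 1 := fun k =>
    add_nonneg (mul_nonneg measureReal_nonneg (Real.log_natCast_nonneg _)) zero_le_one
  rw [integral_eq_lintegral_of_nonneg_ae (ae_of_all _ (neg_log_measure_ball_nonneg ν _))
    (measurable_neg_log_measure_ball ν _).aestronglyMeasurable]
  refine ENNReal.toReal_le_of_le_ofReal (Finset.sum_nonneg fun k _ => hterm k) ?_
  rw [ENNReal.ofReal_sum_of_nonneg fun k _ => hterm k, ← setLIntegral_univ, ← hEuniv]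
  refine (lintegral_iUnion_le _ _).trans ?_
  rw [tsum_fintype]
  exact Finset.sum_le_sum fun k _ => setLIntegral_neg_log_measure_ball_le ν (hn k) (c k) (hE k)

lemma Dq_one (ν : Measure X) (r : ℝ) :
    Dq ν r 1 = (∫ x, -Real.log (ν (ball x r)).toReal ∂ν) / -Real.log r := by
  rw [Dq, if_pos rfl, Iq, if_pos rfl, integral_neg, neg_div_neg_eq]

end Information

section WeakTopology

variable {X : Type*} [MetricSpace X] [MeasurableSpace X] [BorelSpace X]

lemma eventually_lt_measureReal_of_isOpen (μ : ProbabilityMeasure X) {U : Set X}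
    (hU : IsOpen U) {c : ℝ} (hc : c < (μ : Measure X).real U) :
    ∀ᶠ ν : ProbabilityMeasure X in 𝓝 μ, c < (ν : Measure X).real U := by
  rcases lt_or_ge c 0 with h0 | h0
  · exact Eventually.of_forall fun ν => h0.trans_le measureReal_nonneg
  have h := ProbabilityMeasure.le_liminf_measure_open_of_tendsto
    (tendsto_id (α := ProbabilityMeasure X) (x := 𝓝 μ)) hU
  have hlt : ENNReal.ofReal c < (μ : Measure X) U :=
    (ENNReal.ofReal_lt_iff_lt_toReal h0 (measure_ne_top _ _)).2 hc
  filter_upwards [eventually_lt_of_lt_liminf (hlt.trans_le h)] with ν hν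
  exact (ENNReal.ofReal_lt_iff_lt_toReal h0 (measure_ne_top _ _)).1 hν

lemma eventually_measureReal_lt_of_isClosed (μ : ProbabilityMeasure X) {F : Set X}
    (hF : IsClosed F) {c : ℝ} (hc : (μ : Measure X).real F < c) :
    ∀ᶠ ν : ProbabilityMeasure X in 𝓝 μ, (ν : Measure X).real F < c := by
  have h := eventually_lt_measureReal_of_isOpen μ hF.isOpen_compl (c := 1 - c) (by
    rw [probReal_compl_eq_one_sub hF.measurableSet]
    linarith)
  filter_upwards [h] with ν hν
  rw [probReal_compl_eq_one_sub hF.measurableSet] at hν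
  linarith

end WeakTopology

section Atomic

variable {X : Type*} [MeasurableSpace X]

/-- The probability measure with atoms of weight `w i` at the points `c i`. -/
def atomic {ι : Type*} [Fintype ι] (w : ι → ℝ) (hw : ∀ i, 0 < w i) (hsum : ∑ i, w i = 1)
    (c : ι → X) : ProbabilityMeasure X :=
  ⟨∑ i, ENNReal.ofReal (w i) • Measure.dirac (c i), ⟨by
    simp only [Measure.coe_finsetSum, Finset.sum_apply, Measure.smul_apply, measure_univ,
      smul_eq_mul, mul_one]
    rw [← ENNReal.ofReal_sum_of_nonneg fun i _ => (hw i).le, hsum, ENNReal.ofReal_one]⟩⟩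

lemma atomic_real_apply {ι : Type*} [Fintype ι] {w : ι → ℝ} (hw : ∀ i, 0 < w i)
    (hsum : ∑ i, w i = 1) (c : ι → X) {s : Set X} (hs : MeasurableSet s) :
    (atomic w hw hsum c : Measure X).real s = ∑ i, s.indicator (fun _ => w i) (c i) := by
  simp only [atomic, ProbabilityMeasure.coe_mk, Measure.real, Measure.coe_finsetSum,
    Finset.sum_apply, Measure.smul_apply, Measure.dirac_apply' _ hs, smul_eq_mul]
  rw [ENNReal.toReal_sum fun i _ => by
    by_cases h : c i ∈ s <;> simp [h]]
  refine Finset.sum_congr rfl fun i _ => ?_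
  by_cases h : c i ∈ s <;> simp [h, (hw i).le]

lemma integral_atomic [MetricSpace X] [BorelSpace X] {ι : Type*} [Fintype ι] {w : ι → ℝ}
    (hw : ∀ i, 0 < w i) (hsum : ∑ i, w i = 1) (c : ι → X) (f : BoundedContinuousFunction X ℝ) :
    ∫ x, f x ∂(atomic w hw hsum c : Measure X) = ∑ i, w i * f (c i) := by
  simp only [atomic, ProbabilityMeasure.coe_mk]
  rw [integral_finsetSum_measure fun i _ =>
    (f.integrable _).smul_measure ENNReal.ofReal_ne_top]
  refine Finset.sum_congr rfl fun i _ => ?_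
  rw [integral_smul_measure, integral_dirac' _ _ f.continuous.stronglyMeasurable,
    ENNReal.toReal_ofReal (hw i).le, smul_eq_mul]

/-- Atomic measures with finitely many distinct atoms are dense. -/
lemma mem_closure_range_atomic [MetricSpace X] [BorelSpace X]
    [SecondCountableTopology X] (μ : ProbabilityMeasure X) :
    μ ∈ closure {ν | ∃ (S : Finset X) (w : S → ℝ) (hw : ∀ i, 0 < w i) (hsum : ∑ i, w i = 1),
      ν = atomic w hw hsum Subtype.val} := by
  obtain ⟨x₀⟩ := μ.nonempty
  let g : ℕ → SimpleFunc X X := SimpleFunc.approxOn id measurable_id univ x₀ (mem_univ _)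
  have hg : ∀ x, Tendsto (fun n => g n x) atTop (𝓝 x) := fun x =>
    SimpleFunc.tendsto_approxOn measurable_id (mem_univ _) (by simp)
  have hlim : Tendsto (fun n => μ.map (g n).measurable.aemeasurable) atTop (𝓝 μ) := by
    rw [ProbabilityMeasure.tendsto_iff_forall_integral_tendsto]
    intro f
    simp only [ProbabilityMeasure.toMeasure_map]
    have : ∀ n, ∫ x, f x ∂(μ : Measure X).map (g n) = ∫ x, f (g n x) ∂(μ : Measure X) := fun n =>
      integral_map (g n).measurable.aemeasurable f.continuous.aestronglyMeasurable
    simp only [this]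
    refine tendsto_integral_of_dominated_convergence (fun _ => ‖f‖)
      (fun n => (f.continuous.measurable.comp (g n).measurable).aestronglyMeasurable)
      (integrable_const _) (fun n => ae_of_all _ fun x => f.norm_coe_le_norm _)
      (ae_of_all _ fun x => (f.continuous.tendsto x).comp (hg x))
  refine mem_closure_of_tendsto hlim (Eventually.of_forall fun n => ?_)
  classical
  set S : Finset X := (g n).range.filter fun x => (μ : Measure X) (g n ⁻¹' {x}) ≠ 0 with hS
  have hatoms : ∀ t : Set X, MeasurableSet t → (μ : Measure X) (g n ⁻¹' t) =
      ∑ x ∈ S, (μ : Measure X) (g n ⁻¹' {x}) * t.indicator 1 x := by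
    intro t ht
    have h1 : g n ⁻¹' t = g n ⁻¹' ↑((g n).range.filter (· ∈ t)) := by
      ext x
      simp
    rw [h1, ← SimpleFunc.sum_measure_preimage_singleton, Finset.sum_filter, hS,
      Finset.sum_filter]
    refine Finset.sum_congr rfl fun x _ => ?_
    by_cases hx : x ∈ t <;> by_cases h0 : (μ : Measure X) (g n ⁻¹' {x}) = 0 <;> simp [hx, h0]
  have hsum : ∑ x : S, ((μ : Measure X) (g n ⁻¹' {(x : X)})).toReal = 1 := by
    rw [Finset.sum_coe_sort S fun x => ((μ : Measure X) (g n ⁻¹' {x})).toReal,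
      ← ENNReal.toReal_sum fun x _ => measure_ne_top _ _]
    have := hatoms univ MeasurableSet.univ
    simp only [preimage_univ, measure_univ, indicator_univ, Pi.one_apply, mul_one] at this
    rw [← this, ENNReal.toReal_one]
  refine ⟨S, fun x => ((μ : Measure X) (g n ⁻¹' {(x : X)})).toReal, fun x =>
    ENNReal.toReal_pos (Finset.mem_filter.1 x.2).2 (measure_ne_top _ _), hsum, ?_⟩
  refine ProbabilityMeasure.toMeasure_injective (Measure.ext fun t ht => ?_)
  rw [ProbabilityMeasure.toMeasure_map, Measure.map_apply (g n).measurable ht, hatoms t ht]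
  simp only [atomic, ProbabilityMeasure.coe_mk, Measure.coe_finsetSum, Finset.sum_apply,
    Measure.smul_apply, Measure.dirac_apply' _ ht, smul_eq_mul,
    ENNReal.ofReal_toReal (measure_ne_top _ _)]
  exact (Finset.sum_coe_sort S fun x => (μ : Measure X) (g n ⁻¹' {x}) * t.indicator 1 x).symm

lemma sum_sigma_div {κ : Type*} [Fintype κ] {n : κ → ℕ} (hn : ∀ k, 0 < n k) (p : κ → ℝ) :
    ∑ i : (k : κ) × Fin (n k), p i.1 / n i.1 = ∑ k, p k := by
  rw [Fintype.sum_sigma]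
  refine Finset.sum_congr rfl fun k _ => ?_
  have : (n k : ℝ) ≠ 0 := by exact_mod_cast (hn k).ne'
  simp [mul_div_cancel₀ _ this]

/-- The measure obtained from `∑ p k δ_{x k}` by replacing each atom with a uniform measure on
finitely many points. -/
def spread {κ : Type*} [Fintype κ] {p : κ → ℝ} (hp : ∀ k, 0 < p k) (hsum : ∑ k, p k = 1)
    {n : κ → ℕ} (hn : ∀ k, 0 < n k) (c : ∀ k, Fin (n k) → X) : ProbabilityMeasure X :=
  atomic (fun i : (k : κ) × Fin (n k) => p i.1 / n i.1)
    (fun i => div_pos (hp i.1) (by exact_mod_cast hn i.1))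
    ((sum_sigma_div hn p).trans hsum) fun i => c i.1 i.2

/-- If atoms can be spread at arbitrarily small distances inside `V`, then the atomic measure is
in the closure of `V`. -/
lemma atomic_mem_closure_of_spread [MetricSpace X] [BorelSpace X] {κ : Type*} [Fintype κ]
    {p : κ → ℝ} (hp : ∀ k, 0 < p k) (hsum : ∑ k, p k = 1) (x : κ → X)
    {V : Set (ProbabilityMeasure X)}
    (hV : ∀ δ > 0, ∃ (n : κ → ℕ) (hn : ∀ k, 0 < n k) (c : ∀ k, Fin (n k) → X),
      (∀ k j, dist (c k j) (x k) < δ) ∧ spread hp hsum hn c ∈ V) :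
    atomic p hp hsum x ∈ closure V := by
  choose n hn c hc hcV using fun m : ℕ => hV (1 / ((m : ℝ) + 1)) (by positivity)
  refine mem_closure_of_tendsto (f := fun m => spread hp hsum (hn m) (c m)) (b := atTop) ?_
    (Eventually.of_forall hcV)
  rw [ProbabilityMeasure.tendsto_iff_forall_integral_tendsto]
  intro f
  simp only [spread, integral_atomic, Fintype.sum_sigma]
  refine tendsto_finsetSum _ fun k _ => ?_
  rw [Metric.tendsto_nhds]
  intro ε hε
  obtain ⟨δ, hδ, hfδ⟩ := Metric.continuous_iff.1 f.continuous (x k) (ε / p k / 2)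
    (half_pos (div_pos hε (hp k)))
  filter_upwards [tendsto_one_div_add_atTop_nhds_zero_nat.eventually_lt_const hδ] with m hm
  have hn0 : (n m k : ℝ) ≠ 0 := by exact_mod_cast (hn m k).ne'
  have hn1 : (0 : ℝ) < n m k := by exact_mod_cast hn m k
  have heq : ∑ j, p k / n m k * f (c m k j) - p k * f (x k) =
      ∑ j, p k / n m k * (f (c m k j) - f (x k)) := by
    simp only [mul_sub, Finset.sum_sub_distrib, Finset.sum_const, Finset.card_univ,
      Fintype.card_fin, nsmul_eq_mul]
    field_simp
  rw [Real.dist_eq, heq]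
  calc _ ≤ ∑ j : Fin (n m k), p k / n m k * (ε / p k / 2) := by
        refine (Finset.abs_sum_le_sum_abs _ _).trans (Finset.sum_le_sum fun j _ => ?_)
        rw [abs_mul, abs_of_pos (div_pos (hp k) hn1)]
        have := hfδ _ ((hc m k j).trans hm)
        rw [Real.dist_eq] at this
        have hpk := hp k
        gcongr
    _ = ε / 2 := by
        have := (hp k).ne'
        simp only [Finset.sum_const, Finset.card_univ, Fintype.card_fin, nsmul_eq_mul]
        field_simp
    _ < ε := half_lt_self hε

end Atomic

section Separated

/-- Near an atomic measure with `2r`-separated atoms, the information at scale `r` exceeds any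
bound strictly below the entropy of the weights. -/
lemma eventually_lt_integral_neg_log_measure_ball {X : Type*} [MetricSpace X]
    [MeasurableSpace X] [BorelSpace X] [SecondCountableTopology X] [CompactSpace X]
    {ι : Type*} [Fintype ι] {w : ι → ℝ} (hw : ∀ i, 0 < w i) (hsum : ∑ i, w i = 1)
    {c : ι → X} {r : ℝ} (hr : 0 < r) (hsep : ∀ i j, i ≠ j → 2 * r ≤ dist (c i) (c j))
    {T : ℝ} (hT : T < ∑ i, w i * -Real.log (w i)) :
    ∀ᶠ ν : ProbabilityMeasure X in 𝓝 (atomic w hw hsum c),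
      T < ∫ x, -Real.log ((ν : Measure X) (ball x r)).toReal ∂(ν : Measure X) := by
  have hw1 : ∀ i, w i ≤ 1 := fun i =>
    hsum ▸ Finset.single_le_sum (f := w) (fun j _ => (hw j).le) (Finset.mem_univ i)
  have hη : ∃ η > 0, (∀ i, η < w i) ∧
      T < ∑ i, (w i - η) * max 0 (-Real.log (w i + η)) := by
    have hlim : Tendsto (fun η => ∑ i, (w i - η) * max 0 (-Real.log (w i + η))) (𝓝 0)
        (𝓝 (∑ i, (w i - 0) * max 0 (-Real.log (w i + 0)))) := by
      refine tendsto_finsetSum _ fun i _ => ContinuousAt.tendsto ?_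
      have : w i + 0 ≠ 0 := by simpa using (hw i).ne'
      fun_prop (disch := assumption)
    have heq : ∑ i, (w i - 0) * max 0 (-Real.log (w i + 0)) = ∑ i, w i * -Real.log (w i) := by
      refine Finset.sum_congr rfl fun i _ => ?_
      rw [sub_zero, add_zero, max_eq_right (neg_nonneg.2 (Real.log_nonpos (hw i).le (hw1 i)))]
    rw [heq] at hlim
    have h1 : ∀ᶠ η in 𝓝[>] (0 : ℝ), T < ∑ i, (w i - η) * max 0 (-Real.log (w i + η)) :=
      (hlim.mono_left nhdsWithin_le_nhds).eventually (lt_mem_nhds hT)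
    have h2 : ∀ᶠ η in 𝓝[>] (0 : ℝ), ∀ i, η < w i :=
      eventually_all.2 fun i => nhdsWithin_le_nhds (Iio_mem_nhds (hw i))
    obtain ⟨η, h, h', h0⟩ := (h1.and (h2.and self_mem_nhdsWithin)).exists
    exact ⟨η, h0, h', h⟩
  obtain ⟨η, hη0, hηw, hTη⟩ := hη
  have hopen : ∀ i, w i - η < (atomic w hw hsum c : Measure X).real (ball (c i) (r / 2)) := by
    intro i
    rw [atomic_real_apply hw hsum c measurableSet_ball]
    have := Finset.single_le_sum (f := fun j => (ball (c i) (r / 2)).indicator (fun _ => w j) (c j))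
      (fun j _ => indicator_nonneg (fun _ _ => (hw j).le) _) (Finset.mem_univ i)
    simp only [mem_ball, dist_self, half_pos hr, indicator_of_mem] at this
    linarith
  have hclosed : ∀ i,
      (atomic w hw hsum c : Measure X).real (closedBall (c i) (3 * r / 2)) < w i + η := by
    intro i
    rw [atomic_real_apply hw hsum c measurableSet_closedBall, Finset.sum_eq_single i]
    · rw [indicator_of_mem (mem_closedBall_self (by positivity))]
      linarith
    · intro j _ hj
      refine indicator_of_notMem (fun h => ?_) _
      rw [mem_closedBall] at h
      linarith [hsep j i hj]
    · simp
  filter_upwards [eventually_all.2 fun i =>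
      eventually_lt_measureReal_of_isOpen _ isOpen_ball (hopen i),
    eventually_all.2 fun i =>
      eventually_measureReal_lt_of_isClosed _ isClosed_closedBall (hclosed i)] with ν h1 h2
  have hint := integrable_neg_log_measure_ball (ν : Measure X) hr
  have hdisj : Pairwise fun i j => Disjoint (ball (c i) (r / 2)) (ball (c j) (r / 2)) :=
    fun i j hij => ball_disjoint_ball (by linarith [hsep i j hij])
  calc T < ∑ i, (w i - η) * max 0 (-Real.log (w i + η)) := hTη
    _ ≤ ∑ i, ∫ x in ball (c i) (r / 2),
        -Real.log ((ν : Measure X) (ball x r)).toReal ∂(ν : Measure X) := by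
        refine Finset.sum_le_sum fun i _ => ?_
        have hle : ∀ x ∈ ball (c i) (r / 2), max 0 (-Real.log (w i + η)) ≤
            -Real.log ((ν : Measure X) (ball x r)).toReal := by
          intro x hx
          refine max_le (neg_log_measure_ball_nonneg _ _ _) (neg_le_neg ?_)
          rw [mem_ball] at hx
          have hlow : (ν : Measure X).real (ball (c i) (r / 2)) ≤ (ν : Measure X).real (ball x r) :=
            measureReal_mono (ball_subset_ball' (by rw [dist_comm]; linarith))
          have hup : (ν : Measure X).real (ball x r) ≤
              (ν : Measure X).real (closedBall (c i) (3 * r / 2)) :=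
            measureReal_mono
              ((ball_subset_ball' (by linarith)).trans (ball_subset_closedBall (x := c i)))
          exact Real.log_le_log (by linarith [h1 i, hηw i] : 0 < (ν : Measure X).real (ball x r))
            (hup.trans (h2 i).le)
        calc _ ≤ (ν : Measure X).real (ball (c i) (r / 2)) * max 0 (-Real.log (w i + η)) := by
              have := (h1 i).le
              have := le_max_left 0 (-Real.log (w i + η))
              gcongr
          _ = ∫ _ in ball (c i) (r / 2), max 0 (-Real.log (w i + η)) ∂(ν : Measure X) := by
              rw [setIntegral_const, smul_eq_mul]
          _ ≤ _ := setIntegral_mono_on (integrable_const _).integrableOn hint.integrableOn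
              measurableSet_ball hle
    _ = ∫ x in ⋃ i, ball (c i) (r / 2),
        -Real.log ((ν : Measure X) (ball x r)).toReal ∂(ν : Measure X) :=
        (integral_iUnion_fintype (fun i => measurableSet_ball) hdisj
          fun i => hint.integrableOn).symm
    _ ≤ _ := setIntegral_le_integral hint (ae_of_all _ (neg_log_measure_ball_nonneg _ r))

end Separated

section ConvexDimension

lemma convUpperBoxDim_le_limsup {X : Type*} [MetricSpace X] {E : Set X} {ι : Type*} [Fintype ι]
    {x : ι → X} (hx : ∀ i, x i ∈ E) {ρ : ℝ} (hρ : 0 < ρ) {p : ι → ℝ} (hp : ∀ i, 0 < p i)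
    (hsum : ∑ i, p i = 1) :
    convUpperBoxDim E ≤ limsup (fun r : ℝ =>
      (((∑ i, p i * Real.log (_root_.packingNumber (E ∩ ball (x i) ρ) r : ℝ)) / (-Real.log r) : ℝ)
        : EReal)) (𝓝[>] (0:ℝ)) := by
  have hne : Nonempty ι := by
    by_contra h
    rw [not_nonempty_iff] at h
    simp at hsum
  let e := Fintype.equivFin ι
  refine iInf₂_le_of_le (Fintype.card ι) Fintype.card_pos ?_
  refine iInf₂_le_of_le (x ∘ e.symm) (fun i => hx _) ?_
  refine iInf₂_le_of_le ρ hρ ?_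
  refine iInf₂_le_of_le (p ∘ e.symm) (fun i => hp _) ?_
  refine iInf_le_of_le ((e.symm.sum_comp p).trans hsum) ?_
  refine le_of_eq (congrArg (limsup · _) (funext fun r => ?_))
  congr 2
  exact e.symm.sum_comp fun i => p i * Real.log (_root_.packingNumber (E ∩ ball (x i) ρ) r : ℝ)

lemma sum_sigma_div_mul_neg_log {κ : Type*} [Fintype κ] {n : κ → ℕ} (hn : ∀ k, 0 < n k)
    {p : κ → ℝ} (hp : ∀ k, 0 < p k) :
    ∑ i : (k : κ) × Fin (n k), p i.1 / n i.1 * -Real.log (p i.1 / n i.1) =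
      ∑ k, p k * (Real.log (n k) - Real.log (p k)) := by
  rw [Fintype.sum_sigma]
  refine Finset.sum_congr rfl fun k _ => ?_
  have : (n k : ℝ) ≠ 0 := by exact_mod_cast (hn k).ne'
  simp only [Finset.sum_const, Finset.card_univ, Fintype.card_fin, nsmul_eq_mul,
    Real.log_div (hp k).ne' this]
  field_simp
  ring

/-- An atomic measure with almost all of its mass in `ball y ρ` is a limit of measures around
which the information at some small scale `r` exceeds `t' * (-log r)`, for `t'` below the convex
upper box dimension of `K ∩ ball y ρ`. -/
lemma atomic_mem_closure_interior {d : ℕ} {K : Set (Euc d)} (hK : IsCompact K) {y : Euc d}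
    {ρ : ℝ} {t t' ε : ℝ} (ht : (t : EReal) < convUpperBoxDim (K ∩ ball y ρ))
    (hε1 : ε ≤ 1) (hε : ∀ P : ℝ, 1 - ε < P → P ≤ 1 → t' < P * t)
    {S : Finset K} {p : S → ℝ} (hp : ∀ k, 0 < p k) (hsum : ∑ k, p k = 1)
    (hmass : 1 - ε < (atomic p hp hsum Subtype.val : Measure K).real
      (Subtype.val ⁻¹' ball y ρ)) {a : ℝ} (ha : 0 < a) :
    atomic p hp hsum Subtype.val ∈ closure (interior {ν : ProbabilityMeasure K | ∃ r ∈ Ioo 0 a,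
      t' * -Real.log r <
        ∫ x, -Real.log ((ν : Measure K) (ball x r)).toReal ∂(ν : Measure K)}) := by
  classical
  have : CompactSpace K := isCompact_iff_compactSpace.1 hK
  refine atomic_mem_closure_of_spread hp hsum _ fun δ hδ => ?_
  obtain ⟨δ', hδ'sep, hδ'0, hδ'δ⟩ : ∃ δ' : ℝ,
      (∀ k l : S, k ≠ l → 4 * δ' < dist (k : K) (l : K)) ∧ 0 < δ' ∧ δ' < δ := by
    have h1 : ∀ᶠ δ' in 𝓝[>] (0 : ℝ), ∀ k l : S, k ≠ l → 4 * δ' < dist (k : K) (l : K) := by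
      refine eventually_all.2 fun k => eventually_all.2 fun l => ?_
      by_cases hkl : k = l
      · simp [hkl]
      have hpos : 0 < dist (k : K) (l : K) := dist_pos.2 fun h => hkl (Subtype.ext h)
      filter_upwards [nhdsWithin_le_nhds (Iio_mem_nhds (div_pos hpos four_pos))] with δ' h _
      rw [mem_Iio] at h
      linarith
    obtain ⟨δ', h, h'⟩ := (h1.and (Ioo_mem_nhdsGT hδ)).exists
    exact ⟨δ', h, h'⟩
  let Good : S → Prop := fun k => ((k : K) : Euc d) ∈ ball y ρ
  have hGood : ∀ f : S → ℝ, ∑ k : {k // Good k}, f k = ∑ k with Good k, f k := fun f =>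
    (Finset.sum_subtype _ (by simp) f).symm
  set P : ℝ := ∑ k : {k // Good k}, p k with hP
  have hPmass : (atomic p hp hsum Subtype.val : Measure K).real
      (Subtype.val ⁻¹' ball y ρ) = P := by
    rw [atomic_real_apply hp hsum _ (measurable_subtype_coe measurableSet_ball), hP,
      hGood, Finset.sum_filter]
    refine Finset.sum_congr rfl fun k _ => ?_
    simp only [indicator_apply, mem_preimage, Good]
  rw [hPmass] at hmass
  have hP1 : P ≤ 1 := hPmass ▸ measureReal_le_one
  have hP0 : 0 < P := by linarith
  have hlim := ht.trans_le (convUpperBoxDim_le_limsup (E := K ∩ ball y ρ)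
    (x := fun k : {k // Good k} => ((k.1 : K) : Euc d)) (fun k => ⟨k.1.1.2, k.2⟩) hδ'0
    (p := fun k => p k / P) (fun k => div_pos (hp _) hP0)
    (by rw [← Finset.sum_div, div_self hP0.ne']))
  have hsmall : ∀ᶠ r in 𝓝[>] (0 : ℝ), r ∈ Ioo 0 (min (min a δ') 1) :=
    Ioo_mem_nhdsGT (lt_min (lt_min ha hδ'0) one_pos)
  obtain ⟨r, hrt, hr0, hr⟩ :=
    ((frequently_lt_of_lt_limsup (by isBoundedDefault) hlim).and_eventually hsmall).exists
  obtain ⟨⟨hra, hrδ⟩, hr1⟩ : (r < a ∧ r < δ') ∧ r < 1 := by simpa using hr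
  have hlog : 0 < -Real.log r := neg_pos.2 (Real.log_neg hr0 hr1)
  rw [EReal.coe_lt_coe_iff, lt_div_iff₀ hlog] at hrt
  let F : S → Set (Euc d) := fun k =>
    if Good k then K ∩ ball y ρ ∩ ball ((k : K) : Euc d) δ' else {((k : K) : Euc d)}
  have hFself : ∀ k, ((k : K) : Euc d) ∈ F k := by
    intro k
    by_cases hk : Good k
    · simpa only [F, if_pos hk] using ⟨⟨k.1.2, hk⟩, mem_ball_self hδ'0⟩
    · simp only [F, if_neg hk, mem_singleton]
  have hFsub : ∀ k, F k ⊆ K ∩ ball ((k : K) : Euc d) δ' := by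
    intro k
    by_cases hk : Good k
    · simp only [F, if_pos hk]
      exact fun z hz => ⟨hz.1.1, hz.2⟩
    · simp only [F, if_neg hk, singleton_subset_iff]
      exact ⟨k.1.2, mem_ball_self hδ'0⟩
  have hFbdd : ∀ k, Bornology.IsBounded (F k) := fun k =>
    hK.isBounded.subset fun z hz => (hFsub k hz).1
  choose c hcF hcdisj using fun k => exists_packing (hFbdd k) hr0
  have hn : ∀ k, 0 < _root_.packingNumber (F k) r := fun k =>
    packingNumber_pos (hFbdd k) ⟨_, hFself k⟩ hr0
  have hdist : ∀ k j, dist (c k j) ((k : K) : Euc d) < δ' := fun k j => (hFsub k (hcF k j)).2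
  refine ⟨fun k => _root_.packingNumber (F k) r, hn, fun k j => ⟨c k j, (hFsub k (hcF k j)).1⟩,
    fun k j => (hdist k j).trans hδ'δ, ?_⟩
  rw [mem_interior_iff_mem_nhds]
  have hsep : ∀ i j : (k : S) × Fin (_root_.packingNumber (F k) r), i ≠ j →
      2 * r ≤ dist (c i.1 i.2) (c j.1 j.2) := by
    rintro ⟨k, i⟩ ⟨l, j⟩ hij
    by_cases hkl : k = l
    · subst hkl
      exact two_mul_le_dist_of_disjoint_ball (hcdisj k fun h => hij (congrArg (Sigma.mk k) h))
    · have h1 : 4 * δ' < dist ((k : K) : Euc d) ((l : K) : Euc d) := hδ'sep k l hkl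
      have h2 := hdist k i
      have h3 := hdist l j
      have h4 := dist_triangle4 ((k : K) : Euc d) (c k i) (c l j) ((l : K) : Euc d)
      rw [dist_comm ((k : K) : Euc d) (c k i)] at h4
      dsimp only
      linarith
  have hent : t' * -Real.log r < ∑ i : (k : S) × Fin (_root_.packingNumber (F k) r),
      p i.1 / _root_.packingNumber (F i.1) r *
        -Real.log (p i.1 / _root_.packingNumber (F i.1) r) := by
    rw [sum_sigma_div_mul_neg_log hn hp]
    calc t' * -Real.log r < P * t * -Real.log r :=
          mul_lt_mul_of_pos_right (hε P hmass hP1) hlog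
      _ = P * (t * -Real.log r) := mul_assoc _ _ _
      _ ≤ P * ∑ k : {k // Good k}, p k / P *
          Real.log (_root_.packingNumber (K ∩ ball y ρ ∩ ball ((k.1 : K) : Euc d) δ') r) := by
          gcongr
      _ = ∑ k : {k // Good k}, p k * Real.log (_root_.packingNumber (F k) r) := by
          rw [Finset.mul_sum]
          refine Finset.sum_congr rfl fun k _ => ?_
          simp only [F, if_pos k.2]
          field_simp
      _ ≤ ∑ k, p k * Real.log (_root_.packingNumber (F k) r) := by
          rw [hGood fun k => p k * Real.log (_root_.packingNumber (F k) r)]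
          exact Finset.sum_le_sum_of_subset_of_nonneg (Finset.filter_subset _ _) fun k _ _ =>
            mul_nonneg (hp k).le (Real.log_natCast_nonneg _)
      _ ≤ _ := by
          refine Finset.sum_le_sum fun k _ => mul_le_mul_of_nonneg_left ?_ (hp k).le
          have : p k ≤ 1 :=
            hsum ▸ Finset.single_le_sum (f := p) (fun j _ => (hp j).le) (Finset.mem_univ k)
          linarith [Real.log_nonpos (hp k).le this]
  filter_upwards [eventually_lt_integral_neg_log_measure_ball (X := K)
    (c := fun i : (k : S) × Fin (_root_.packingNumber (F k) r) =>
      ⟨c i.1 i.2, (hFsub i.1 (hcF i.1 i.2)).1⟩) _ _ hr0 hsep hent] with ν hν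
  exact ⟨r, ⟨hr0, hra⟩, hν⟩

end ConvexDimension

section Optimality

/-- A dense `G_δ` set of measures contains one with upper `L¹`-dimension at least `t'`, for `t'`
below a local convex upper box dimension. -/
lemma exists_le_upperDim_one {d : ℕ} {K : Set (Euc d)} (hK : IsCompact K)
    {G : Set (ProbabilityMeasure K)} (hGd : Dense G) (hGδ : IsGδ G) {y : Euc d} (hy : y ∈ K)
    {ρ : ℝ} (hρ : 0 < ρ) {t t' : ℝ} (htt' : t' < t)
    (ht : (t : EReal) < convUpperBoxDim (K ∩ ball y ρ)) :
    ∃ μ ∈ G, (t' : EReal) ≤ upperDim (μ : Measure K) 1 := by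
  have : CompactSpace K := isCompact_iff_compactSpace.1 hK
  obtain ⟨ε, hε0, hε1, hε⟩ : ∃ ε : ℝ, 0 < ε ∧ ε ≤ 1 ∧
      ∀ P : ℝ, 1 - ε < P → P ≤ 1 → t' < P * t := by
    have hlim : Tendsto (fun P : ℝ => P * t) (𝓝 1) (𝓝 (1 * t)) :=
      (continuous_id.mul continuous_const).tendsto 1
    rw [one_mul] at hlim
    obtain ⟨ε, hε0, hε⟩ := Metric.eventually_nhds_iff.1 (hlim.eventually (lt_mem_nhds htt'))
    refine ⟨min ε 1, lt_min hε0 one_pos, min_le_right _ _, fun P hP hP1 => hε ?_⟩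
    rw [Real.dist_eq, abs_sub_lt_iff]
    have := min_le_left ε 1
    constructor <;> linarith
  let U : Set (ProbabilityMeasure K) :=
    {ν | 1 - ε < (ν : Measure K).real (Subtype.val ⁻¹' ball y ρ)}
  have hUopen : IsOpen U := isOpen_iff_mem_nhds.2 fun μ hμ =>
    eventually_lt_measureReal_of_isOpen μ (isOpen_ball.preimage continuous_subtype_val) hμ
  have hUne : U.Nonempty := by
    refine ⟨atomic (fun _ : Unit => 1) (fun _ => one_pos) (by simp) fun _ => ⟨y, hy⟩, ?_⟩
    change 1 - ε < _
    rw [atomic_real_apply _ _ _ (measurable_subtype_coe measurableSet_ball)]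
    simp [hρ, hε0]
  let V : ℕ → Set (ProbabilityMeasure K) := fun m => interior {ν | ∃ r ∈ Ioo 0 (1 / ((m : ℝ) + 1)),
    t' * -Real.log r < ∫ x, -Real.log ((ν : Measure K) (ball x r)).toReal ∂(ν : Measure K)}
  have hUV : ∀ m, U ⊆ closure (V m) := by
    intro m μ hμ
    have hmem := hUopen.inter_closure ⟨hμ, mem_closure_range_atomic μ⟩
    refine closure_minimal ?_ isClosed_closure hmem
    rintro _ ⟨hU, S, p, hp, hsum, rfl⟩
    exact atomic_mem_closure_interior hK ht hε1 hε hp hsum hU (by positivity)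
  have hW : Dense (⋂ m, V m ∪ (closure U)ᶜ) := by
    refine dense_iInter_of_isOpen
      (fun m => isOpen_interior.union isClosed_closure.isOpen_compl) fun m => ?_
    intro μ
    by_cases hμ : μ ∈ closure U
    · exact closure_mono subset_union_left (closure_minimal (hUV m) isClosed_closure hμ)
    · exact subset_closure (Or.inr hμ)
  have hWδ : IsGδ (⋂ m, V m ∪ (closure U)ᶜ) := .iInter fun m =>
    (isOpen_interior.union isClosed_closure.isOpen_compl).isGδ
  obtain ⟨μ, hμU, hμG, hμW⟩ := (hGd.inter_of_Gδ hGδ hWδ hW).inter_open_nonempty U hUopen hUne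
  refine ⟨μ, hμG, le_limsup_of_frequently_le' ?_⟩
  rw [frequently_nhdsWithin_iff, Metric.nhds_basis_ball.frequently_iff]
  intro δ hδ
  obtain ⟨m, hm⟩ := exists_nat_one_div_lt (lt_min hδ one_pos)
  have hμV : μ ∈ V m := (mem_iInter.1 hμW m).resolve_right fun h => h (subset_closure hμU)
  obtain ⟨r, ⟨hr0, hr⟩, hI⟩ := interior_subset hμV
  have hr1 := hr.trans hm
  refine ⟨r, ?_, ?_, hr0⟩
  · rw [mem_ball, Real.dist_0_eq_abs, abs_of_pos hr0]
    exact hr1.trans_le (min_le_left _ _)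
  · rw [EReal.coe_le_coe_iff, Dq_one,
      le_div_iff₀ (neg_pos.2 (Real.log_neg hr0 (hr1.trans_le (min_le_right _ _))))]
    exact hI.le

/-- Every dense set of measures contains one whose upper `L¹`-dimension is at most `s'`, for `s'`
above one of the upper limits defining the convex upper box dimension. -/
lemma exists_upperDim_one_le {d : ℕ} {K : Set (Euc d)} (hK : IsCompact K)
    {G : Set (ProbabilityMeasure K)} (hGd : Dense G) {N : ℕ} {x : Fin N → Euc d}
    (hx : ∀ i, x i ∈ K) {ρ : ℝ} (hρ : 0 < ρ) {p : Fin N → ℝ} (hp : ∀ i, 0 < p i)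
    (hsum : ∑ i, p i = 1) {s s' : ℝ} (hss' : s < s')
    (hs : limsup (fun r : ℝ =>
      (((∑ i, p i * Real.log (_root_.packingNumber (K ∩ ball (x i) ρ) r : ℝ)) / (-Real.log r) : ℝ)
        : EReal)) (𝓝[>] (0:ℝ)) < s) :
    ∃ μ ∈ G, upperDim (μ : Measure K) 1 ≤ (s' : EReal) := by
  classical
  let x' : Fin N → K := fun i => ⟨x i, hx i⟩
  let S : Finset K := Finset.univ.image x'
  let q : K → ℝ := fun y => ∑ i with x' i = y, p i
  have hxS : ∀ i, x' i ∈ S := fun i => Finset.mem_image_of_mem _ (Finset.mem_univ i)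
  have hKne : K.Nonempty := by
    rcases isEmpty_or_nonempty (Fin N) with h | ⟨⟨i⟩⟩
    · simp at hsum
    · exact ⟨x i, hx i⟩
  obtain ⟨ρ', hsep, hρ'0, hρ'ρ⟩ : ∃ ρ' : ℝ,
      (∀ y ∈ S, ∀ i, x' i ≠ y → ρ' < dist (x' i) y) ∧ 0 < ρ' ∧ ρ' < ρ := by
    have h1 : ∀ᶠ ρ' in 𝓝[>] (0 : ℝ), ∀ y ∈ S, ∀ i, x' i ≠ y → ρ' < dist (x' i) y := by
      refine (Finset.eventually_all S).2 fun y _ => eventually_all.2 fun i => ?_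
      by_cases hiy : x' i = y
      · simp [hiy]
      filter_upwards [nhdsWithin_le_nhds (Iio_mem_nhds (dist_pos.2 hiy))] with δ' h _ using h
    obtain ⟨ρ', h, h'⟩ := (h1.and (Ioo_mem_nhdsGT hρ)).exists
    exact ⟨ρ', h, h'⟩
  let μ₀ : ProbabilityMeasure K := atomic p hp hsum x'
  set C : ℝ := (S.card + 1) * (d + 1) with hC
  have hC0 : 0 < C := by positivity
  set η : ℝ := (s' - s) / 2 / C with hη
  have hη0 : 0 < η := by
    have := sub_pos.2 hss'
    positivity
  have hatom : ∀ y ∈ S, (μ₀ : Measure K).real (closedBall y ρ') < q y + η := by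
    intro y hy
    rw [atomic_real_apply hp hsum x' measurableSet_closedBall]
    have : ∑ i, (closedBall y ρ').indicator (fun _ => p i) (x' i) = q y := by
      simp only [q, Finset.sum_filter]
      refine Finset.sum_congr rfl fun i _ => ?_
      by_cases hiy : x' i = y
      · simp [hiy, hρ'0.le]
      · rw [if_neg hiy, indicator_of_notMem]
        rw [mem_closedBall, not_le]
        exact hsep y hy i hiy
    linarith
  have hrest : (μ₀ : Measure K).real (⋃ y ∈ S, ball y ρ')ᶜ < η := by
    have hmeas : MeasurableSet (⋃ y ∈ S, ball y ρ')ᶜ :=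
      (isOpen_biUnion fun _ _ => isOpen_ball).isClosed_compl.measurableSet
    rw [atomic_real_apply hp hsum x' hmeas]
    refine (Finset.sum_eq_zero fun i _ => indicator_of_notMem (fun h => ?_) _).trans_lt hη0
    exact h (mem_biUnion (hxS i) (mem_ball_self hρ'0))
  have hnear : ∀ᶠ ν : ProbabilityMeasure K in 𝓝 μ₀,
      (∀ y ∈ S, (ν : Measure K).real (closedBall y ρ') < q y + η) ∧
      (ν : Measure K).real (⋃ y ∈ S, ball y ρ')ᶜ < η :=
    ((Finset.eventually_all S).2 fun y hy =>
      eventually_measureReal_lt_of_isClosed μ₀ isClosed_closedBall (hatom y hy)).and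
    (eventually_measureReal_lt_of_isClosed μ₀
      (isOpen_biUnion fun _ _ => isOpen_ball).isClosed_compl hrest)
  obtain ⟨μ, ⟨hμS, hμrest⟩, hμG⟩ :=
    ((mem_closure_iff_frequently.1 (hGd μ₀)).and_eventually hnear).exists.imp fun _ h => h.symm
  refine ⟨μ, hμG, limsup_le_of_le (by isBoundedDefault) ?_⟩
  have hscale : Tendsto (fun R : ℝ => R / 4) (𝓝[>] 0) (𝓝[>] 0) := by
    refine tendsto_nhdsWithin_iff.2 ⟨?_, ?_⟩
    · have : Tendsto (fun R : ℝ => R / 4) (𝓝 0) (𝓝 (0 / 4)) := tendsto_id.div_const 4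
      rw [zero_div] at this
      exact this.mono_left nhdsWithin_le_nhds
    · filter_upwards [self_mem_nhdsWithin] with R hR
      exact div_pos (mem_Ioi.1 hR) (by norm_num : (0 : ℝ) < 4)
  have hsmall : ∀ᶠ r in 𝓝[>] (0 : ℝ), r ∈ Ioo (0 : ℝ) (1 / 4) :=
    Ioo_mem_nhdsGT (by norm_num)
  have hev := (((eventually_lt_of_limsup_lt hs).and
    (eventually_log_packingNumber_le hK.isBounded hKne)).and
    ((tendsto_neg_log_nhdsGT_zero.eventually_ge_atTop
      ((S.card + 1 + s' * Real.log 4) / ((s' - s) / 2))).and hsmall))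
  filter_upwards [hscale.eventually hev] with R hR
  obtain ⟨r, rfl⟩ : ∃ r, R = 2 * (2 * r) := ⟨R / 4, by ring⟩
  rw [show 2 * (2 * r) / 4 = r by ring] at hR
  obtain ⟨⟨hrs, hrK⟩, hrlarge, hr0, hr4⟩ := hR
  have hlogr : 0 < -Real.log r := neg_pos.2 (Real.log_neg hr0 (by linarith))
  rw [EReal.coe_lt_coe_iff, div_lt_iff₀ hlogr] at hrs
  rw [div_le_iff₀ (half_pos (sub_pos.2 hss'))] at hrlarge
  have hlog4 : -Real.log (2 * (2 * r)) = -Real.log r - Real.log 4 := by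
    rw [← mul_assoc, Real.log_mul (by norm_num) hr0.ne']
    norm_num
    ring
  have hlogR : 0 < -Real.log (2 * (2 * r)) :=
    neg_pos.2 (Real.log_neg (by positivity) (by linarith))
  rw [EReal.coe_le_coe_iff, Dq_one, div_le_iff₀ hlogR, hlog4]
  let F : Option S → Set (Euc d) := fun k =>
    k.elim K fun y => K ∩ ball ((y : K) : Euc d) ρ'
  let E : Option S → Set K := fun k =>
    k.elim (⋃ y ∈ S, ball y ρ')ᶜ fun y => ball (y : K) ρ'
  have hFK : ∀ k, F k ⊆ K := by
    rintro (_ | y)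
    · exact subset_rfl
    · exact inter_subset_left
  have hFne : ∀ k, (F k).Nonempty := by
    rintro (_ | y)
    · exact hKne
    · exact ⟨y.1, y.1.2, mem_ball_self hρ'0⟩
  have hFbdd : ∀ k, Bornology.IsBounded (F k) := fun k => hK.isBounded.subset (hFK k)
  have hEF : ∀ k, ∀ z ∈ E k, (z : Euc d) ∈ F k := by
    rintro (_ | y) z hz
    · exact z.2
    · exact ⟨z.2, hz⟩
  have hEuniv : ⋃ k, E k = univ := by
    refine eq_univ_of_forall fun z => mem_iUnion.2 ?_
    by_cases hz : z ∈ ⋃ y ∈ S, ball y ρ'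
    · obtain ⟨y, hy, hzy⟩ := mem_iUnion₂.1 hz
      exact ⟨some ⟨y, hy⟩, hzy⟩
    · exact ⟨none, hz⟩
  choose c hcF hcov using fun k => exists_packing_cover (hFbdd k) hr0
  have hI := integral_neg_log_measure_ball_le (μ : Measure K) hEuniv (s := 2 * r)
    (fun k => _root_.packingNumber (F k) r) (fun k => packingNumber_pos (hFbdd k) (hFne k) hr0)
    (fun k j => ⟨c k j, hFK k (hcF k j)⟩) fun k z hz => hcov k z (hEF k z hz)
  refine hI.trans ?_
  have hlogF : ∀ k, Real.log (_root_.packingNumber (F k) r) ≤ (d + 1) * -Real.log r := fun k =>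
    (Real.log_le_log (by exact_mod_cast packingNumber_pos (hFbdd k) (hFne k) hr0)
      (by exact_mod_cast packingNumber_mono hK.isBounded (hFK k) hr0)).trans hrK
  have hlogF0 : ∀ k, 0 ≤ Real.log (_root_.packingNumber (F k) r) := fun k =>
    Real.log_natCast_nonneg _
  have hnone : (μ : Measure K).real (E none) * Real.log (_root_.packingNumber (F none) r) ≤
      η * ((d + 1) * -Real.log r) :=
    mul_le_mul hμrest.le (hlogF none) (hlogF0 none) hη0.le
  have hsome : ∀ y : S, (μ : Measure K).real (E (some y)) *
      Real.log (_root_.packingNumber (F (some y)) r) ≤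
      q y * Real.log (_root_.packingNumber (F (some y)) r) + η * ((d + 1) * -Real.log r) := by
    intro y
    have h1 : (μ : Measure K).real (E (some y)) ≤ q y + η :=
      (measureReal_mono ball_subset_closedBall).trans (hμS y y.2).le
    calc _ ≤ (q y + η) * Real.log (_root_.packingNumber (F (some y)) r) :=
          mul_le_mul_of_nonneg_right h1 (hlogF0 _)
      _ ≤ _ := by
          rw [add_mul]
          gcongr
          exact hlogF _
  have hfiber : ∑ y : S, q y * Real.log (_root_.packingNumber (F (some y)) r) ≤
      s * -Real.log r := by
    have hfib : ∑ y : S, q y * Real.log (_root_.packingNumber (F (some y)) r) =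
        ∑ i, p i * Real.log (_root_.packingNumber (K ∩ ball (x i) ρ') r) := by
      refine (Finset.sum_coe_sort S fun y : K =>
        q y * Real.log (_root_.packingNumber (K ∩ ball (y : Euc d) ρ') r)).trans ?_
      rw [← Finset.sum_fiberwise_of_maps_to (s := Finset.univ) (t := S) (g := x')
          fun i _ => hxS i]
      refine Finset.sum_congr rfl fun y _ => ?_
      rw [Finset.sum_mul]
      refine Finset.sum_congr rfl fun i hi => ?_
      rw [← (Finset.mem_filter.1 hi).2]
    refine hfib.trans_le (le_trans (Finset.sum_le_sum fun i _ =>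
      mul_le_mul_of_nonneg_left ?_ (hp i).le) hrs.le)
    have hbdd : ∀ τ, Bornology.IsBounded (K ∩ ball (x i) τ) := fun τ =>
      hK.isBounded.subset inter_subset_left
    refine Real.log_le_log ?_ ?_
    · exact_mod_cast packingNumber_pos (hbdd _) ⟨x i, hx i, mem_ball_self hρ'0⟩ hr0
    · exact_mod_cast packingNumber_mono (hbdd _)
        (inter_subset_inter_right _ (ball_subset_ball hρ'ρ.le)) hr0
  have hsum_some := Finset.sum_le_sum fun (y : S) (_ : y ∈ Finset.univ) => hsome y
  rw [Finset.sum_add_distrib, Finset.sum_const, Finset.card_univ, Fintype.card_coe,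
    nsmul_eq_mul] at hsum_some
  rw [Fintype.sum_option, Finset.sum_add_distrib, Finset.sum_const, Finset.card_univ,
    Fintype.card_coe, nsmul_eq_mul, mul_one]
  have hηC : η * C = (s' - s) / 2 := div_mul_cancel₀ _ hC0.ne'
  have hηlog : η * ((d + 1) * -Real.log r) + S.card * (η * ((d + 1) * -Real.log r)) =
      (s' - s) / 2 * -Real.log r := by
    rw [← hηC, hC]
    ring
  linarith

end Optimality

/-- Optimality: if `[a,b]` is an interval such that the set of measures with
`D̄_μ(1) ∈ [a,b]` is residual, then `a ≤ dim̄_{B,conv}(K)` and `b ≥ dim̄_{B,conv,max}(K)`. -/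
theorem L1_interval_optimal (d : ℕ) (K : Set (Euc d))
    (hK : IsCompact K) (hKinf : K.Infinite) (a b : ℝ)
    (h : ∃ G : Set (ProbabilityMeasure ↥K),
      G ⊆ {μ : ProbabilityMeasure ↥K |
        (a : EReal) ≤ upperDim (μ : Measure ↥K) 1 ∧
        upperDim (μ : Measure ↥K) 1 ≤ (b : EReal)} ∧
      Dense G ∧ IsGδ G) :
    (a : EReal) ≤ convUpperBoxDim K ∧ convUpperBoxDimMax K ≤ (b : EReal) := by
  obtain ⟨G, hG, hGd, hGδ⟩ := h
  constructor
  · refine le_iInf₂ fun N _ => le_iInf₂ fun x hx => le_iInf₂ fun ρ hρ => le_iInf₂ fun p hp =>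
      le_iInf fun hsum => le_of_forall_gt fun c hc => ?_
    obtain ⟨s', hs', hs'c⟩ := EReal.lt_iff_exists_real_btwn.1 hc
    obtain ⟨s, hs, hss'⟩ := EReal.lt_iff_exists_real_btwn.1 hs'
    obtain ⟨μ, hμ, hle⟩ :=
      exists_upperDim_one_le hK hGd hx hρ hp hsum (EReal.coe_lt_coe_iff.1 hss') hs
    exact ((hG hμ).1.trans hle).trans_lt hs'c
  · refine iSup₂_le fun y hy => iSup₂_le fun ρ hρ => le_of_forall_lt fun c hc => ?_
    obtain ⟨t', hct', ht'⟩ := EReal.lt_iff_exists_real_btwn.1 hc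
    obtain ⟨t, htt', ht⟩ := EReal.lt_iff_exists_real_btwn.1 ht'
    obtain ⟨μ, hμ, hle⟩ :=
      exists_le_upperDim_one hK hGd hGδ hy hρ (EReal.coe_lt_coe_iff.1 htt') ht
    exact hct'.trans_le (hle.trans (hG hμ).2)

end
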